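/- arXiv:1203.5462 — 2 statements merged into one kernel-verified Lean document; each statement's English description precedes it below -/
import Mathlib

section
/- For even dimension d ∈ ℕ, d ≥ 1, the surface integral of the exponential of a linear form over the unit sphere S^{d−1} ⊂ ℝ^d equals a renormalized I-Bessel function: ∫_{S^{d−1}} e^{r ω·η} dω = 2π^{d/2} Ĩ_{d/2−1}(r) for every unit vector η ∈ S^{d−1} and r ≥ 0, where Ĩ_α(r) = (r/2)^{−α} I_α(r) and dω is the standard surface measure. -/
open MeasureTheory
open scoped RealInnerProductSpace

lemma gamma_half (k : ℕ) : Real.Gamma ((k:ℝ) + 1/2) * (4^k * k.factorial) = (2*k).factorial * √Real.pi := by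
  induction k with
  | zero => simp [-one_div, Real.Gamma_one_half_eq]
  | succ k ih =>
    have h : ((k+1:ℕ):ℝ) + 1/2 = ((k:ℝ)+1/2) + 1 := by push_cast; ring
    rw [h, Real.Gamma_add_one (by positivity)]
    have : 2 * (k+1) = 2*k+1+1 := by ring
    rw [this, Nat.factorial_succ, Nat.factorial_succ, Nat.factorial_succ]
    push_cast
    linear_combination ((k:ℝ)+1/2) * 4 * (k+1) * ih

lemma rad_int (n : ℕ) : ∫ t in Set.Ioi (0:ℝ), t^n * Real.exp (-t^2) = Real.Gamma (((n:ℝ)+1)/2) / 2 := by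
  have := integral_rpow_mul_exp_neg_rpow (p := 2) (q := (n:ℝ)) (by norm_num) (by have := n.cast_nonneg (α := ℝ); linarith)
  rw [show (1:ℝ)/2 * Real.Gamma (((n:ℝ)+1)/2) = Real.Gamma (((n:ℝ)+1)/2) / 2 by ring] at this
  rw [← this]
  refine setIntegral_congr_fun measurableSet_Ioi fun x hx ↦ ?_
  simp

lemma line_even (k : ℕ) : ∫ t : ℝ, t^(2*k) * Real.exp (-t^2) = Real.Gamma ((k:ℝ)+1/2) := by
  have := integral_comp_abs (f := fun t : ℝ => t^(2*k) * Real.exp (-t^2))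
  simp only [sq_abs, pow_mul] at this
  simp only [pow_mul]
  rw [this]
  simp only [← pow_mul]
  rw [rad_int]
  push_cast
  rw [show (2*(k:ℝ)+1)/2 = k+1/2 by ring]; ring

lemma line_odd (n : ℕ) (hn : Odd n) : ∫ t : ℝ, t^n * Real.exp (-t^2) = 0 := by
  have := integral_neg_eq_self (fun t : ℝ => t^n * Real.exp (-t^2)) volume
  simp only [hn.neg_pow, even_two.neg_pow, neg_mul, integral_neg] at this
  linarith

lemma space_int (d : ℕ) (hd : 1 ≤ d) (η : EuclideanSpace ℝ (Fin d)) (hη : ‖η‖ = 1) (n : ℕ) :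
    ∫ x : EuclideanSpace ℝ (Fin d), ⟪x, η⟫ ^ n * Real.exp (-‖x‖^2)
      = (∫ t : ℝ, t^n * Real.exp (-t^2)) * √Real.pi ^ (d-1) := by
  let i0 : Fin d := ⟨0, hd⟩
  obtain ⟨b, hb⟩ := Orthonormal.exists_orthonormalBasis_extension_of_card_eq (𝕜 := ℝ)
    (E := EuclideanSpace ℝ (Fin d)) (ι := Fin d) (by simp) (v := fun _ => η) (s := {i0}) (by
      constructor
      · intro i; simpa using hη
      · intro i j hij; exact absurd (Subsingleton.elim i j) hij)
  have hb0 : b i0 = η := hb i0 rfl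
  have h1 := b.measurePreserving_repr_symm.integral_comp
    (b.repr.symm.toHomeomorph.measurableEmbedding)
    (fun x : EuclideanSpace ℝ (Fin d) => ⟪x, η⟫ ^ n * Real.exp (-‖x‖^2))
  have h2 := (PiLp.volume_preserving_toLp (Fin d)).integral_comp
    (MeasurableEquiv.toLp 2 _).measurableEmbedding
    (fun x : EuclideanSpace ℝ (Fin d) => (x i0) ^ n * Real.exp (-‖x‖^2))
  have h3 : ∀ x : EuclideanSpace ℝ (Fin d), ⟪b.repr.symm x, η⟫ = x i0 := by
    intro x
    rw [← hb0, real_inner_comm, ← b.repr_apply_apply]; simp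
  simp only [h3, LinearIsometryEquiv.norm_map] at h1
  rw [← h1, ← h2]
  have h4 := integral_fintype_prod_volume_eq_prod (ι := Fin d) (E := fun _ => ℝ) (𝕜 := ℝ)
    (fun i t => (if i = i0 then t^n else 1) * Real.exp (-t^2))
  have h5 : ∀ x : Fin d → ℝ, (∏ i, (if i = i0 then (x i)^n else 1) * Real.exp (-(x i)^2)) =
      (x i0) ^ n * Real.exp (-‖WithLp.toLp 2 x‖^2) := by
    intro x
    rw [Finset.prod_mul_distrib, Finset.prod_ite_eq' , ← Real.exp_sum, EuclideanSpace.norm_sq_eq]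
    simp
  simp only [h5] at h4
  refine h4.trans ?_
  rw [← Finset.mul_prod_erase _ _ (Finset.mem_univ i0)]
  have h6 : ∏ i ∈ Finset.univ.erase i0, ∫ x : ℝ, (if i = i0 then x ^ n else 1) * Real.exp (-x ^ 2) = √Real.pi ^ (d-1) := by
    rw [Finset.prod_congr rfl (g := fun _ => √Real.pi)]
    · simp
    · intro i hi
      have := integral_gaussian 1
      simpa [Finset.ne_of_mem_erase hi] using this
  rw [h6]
  simp only [if_true]

lemma polar (d : ℕ) (hd : 1 ≤ d) (η : EuclideanSpace ℝ (Fin d)) (n : ℕ) :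
    ∫ x : EuclideanSpace ℝ (Fin d), ⟪x, η⟫ ^ n * Real.exp (-‖x‖^2)
      = (∫ ω : Metric.sphere (0 : EuclideanSpace ℝ (Fin d)) 1,
        ⟪(ω : EuclideanSpace ℝ (Fin d)), η⟫ ^ n
        ∂((volume : Measure (EuclideanSpace ℝ (Fin d))).toSphere)) *
        (Real.Gamma (((n:ℝ)+d)/2) / 2) := by
  set μ := (volume : Measure (EuclideanSpace ℝ (Fin d)))
  have : Nonempty (Fin d) := ⟨⟨0, hd⟩⟩
  have e : (((n + (d-1) : ℕ):ℝ)+1)/2 = ((n:ℝ)+d)/2 := by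
    push_cast [Nat.cast_sub hd]; ring
  rw [← e, ← rad_int]
  calc
    _ = ∫ x : ({(0)}ᶜ : Set (EuclideanSpace ℝ (Fin d))), ⟪x.1, η⟫ ^ n * Real.exp (-‖x.1‖^2) ∂(μ.comap (↑)) := by
      rw [integral_subtype_comap (measurableSet_singleton _).compl fun x ↦ ⟪x, η⟫ ^ n * Real.exp (-‖x‖^2),
        restrict_compl_singleton]
    _ = ∫ x, ⟪x.1.1, η⟫ ^ n * (x.2.1 ^ n * Real.exp (-x.2.1^2)) ∂μ.toSphere.prod (.volumeIoiPow (Module.finrank ℝ (EuclideanSpace ℝ (Fin d)) - 1)) := by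
      rw [← μ.measurePreserving_homeomorphUnitSphereProd.integral_comp
        (Homeomorph.measurableEmbedding _)]
      refine integral_congr_ae (.of_forall fun x => ?_)
      have hx : ‖x.1‖ ≠ 0 := norm_ne_zero_iff.2 x.2
      simp only [homeomorphUnitSphereProd_apply_snd_coe, homeomorphUnitSphereProd_apply_fst_coe, real_inner_smul_left, mul_pow, inv_pow]
      field_simp
    _ = (∫ ω, ⟪ω.1, η⟫ ^ n ∂μ.toSphere) * ∫ x : Set.Ioi (0 : ℝ), (x.1 ^ n * Real.exp (-x.1^2)) ∂.volumeIoiPow (Module.finrank ℝ (EuclideanSpace ℝ (Fin d)) - 1) :=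
      integral_prod_mul (fun ω : Metric.sphere (0 : EuclideanSpace ℝ (Fin d)) 1 => ⟪ω.1, η⟫ ^ n) (fun x : Set.Ioi (0 : ℝ) => (x.1 ^ n * Real.exp (-x.1^2)))
    _ = _ := by
      congr 1
      simp only [Measure.volumeIoiPow, ENNReal.ofReal]
      rw [integral_withDensity_eq_integral_smul,
        integral_subtype_comap measurableSet_Ioi fun a ↦ Real.toNNReal (a ^ (Module.finrank ℝ (EuclideanSpace ℝ (Fin d)) - 1)) • (a ^ n * Real.exp (-a^2)),
        setIntegral_congr_fun measurableSet_Ioi fun x hx ↦ ?_]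
      · rw [NNReal.smul_def, Real.coe_toNNReal _ (pow_nonneg (Set.mem_Ioi.1 hx).le _)]
        simp; ring
      · exact (measurable_subtype_coe.pow_const _).real_toNNReal

theorem stmt_14 (d : ℕ) (hd : 1 ≤ d) (heven : Even d)
    (η : EuclideanSpace ℝ (Fin d)) (hη : ‖η‖ = 1) (r : ℝ) (hr : 0 ≤ r) :
    ∫ ω : Metric.sphere (0 : EuclideanSpace ℝ (Fin d)) 1,
        Real.exp (r * ⟪(ω : EuclideanSpace ℝ (Fin d)), η⟫)
        ∂((volume : Measure (EuclideanSpace ℝ (Fin d))).toSphere)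
      = 2 * Real.pi ^ ((d : ℝ) / 2)
        * ∑' n : ℕ, (r ^ 2 / 4) ^ n / ((n.factorial : ℝ) * Real.Gamma ((n : ℝ) + (d : ℝ) / 2)) := by
  have hdpos : (0:ℝ) < d := by exact_mod_cast hd
  have key := fun n => (polar d hd η n).symm.trans (space_int d hd η hη n)
  set μ := (volume : Measure (EuclideanSpace ℝ (Fin d)))
  have hs : HasSum (fun n : ℕ => ∫ ω : Metric.sphere (0 : EuclideanSpace ℝ (Fin d)) 1,
      r ^ n / n.factorial * ⟪(ω : EuclideanSpace ℝ (Fin d)), η⟫ ^ n ∂μ.toSphere)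
      (∫ ω : Metric.sphere (0 : EuclideanSpace ℝ (Fin d)) 1,
        Real.exp (r * ⟪(ω : EuclideanSpace ℝ (Fin d)), η⟫) ∂μ.toSphere) := by
    refine hasSum_integral_of_dominated_convergence (fun n _ => r ^ n / n.factorial) ?_ ?_ ?_ ?_ ?_
    · intro n
      apply Continuous.aestronglyMeasurable
      fun_prop
    · intro n
      refine .of_forall fun ω => ?_
      rw [norm_mul, norm_pow, Real.norm_of_nonneg (by positivity : 0 ≤ r ^ n / n.factorial)]
      refine mul_le_of_le_one_right (by positivity) (pow_le_one₀ (norm_nonneg _) ?_)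
      have := norm_inner_le_norm (𝕜 := ℝ) (ω : EuclideanSpace ℝ (Fin d)) η
      have h1 : ‖(ω : EuclideanSpace ℝ (Fin d))‖ = 1 := by simp
      simpa [h1, hη] using this
    · exact .of_forall fun _ => Real.summable_pow_div_factorial r
    · exact integrable_const _
    · refine .of_forall fun ω => ?_
      have := NormedSpace.expSeries_div_hasSum_exp (r * ⟪(ω : EuclideanSpace ℝ (Fin d)), η⟫)
      rw [← Real.exp_eq_exp_ℝ] at this
      have h2 : (fun n : ℕ => r ^ n / n.factorial * ⟪(ω : EuclideanSpace ℝ (Fin d)), η⟫ ^ n) = fun n : ℕ => (r * ⟪(ω : EuclideanSpace ℝ (Fin d)), η⟫) ^ n / n.factorial := by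
        funext n; rw [mul_pow]; ring
      rw [← h2] at this; exact this
  simp only [integral_const_mul] at hs
  have hinj : Function.Injective (fun k : ℕ => 2 * k) := fun a b h => by simpa using h
  rw [← hinj.hasSum_iff] at hs
  · rw [← hs.tsum_eq, ← tsum_mul_left]
    refine tsum_congr fun k => ?_
    have hk := key (2*k)
    rw [line_even] at hk
    have e : (((2*k:ℕ):ℝ)+d)/2 = k + d/2 := by push_cast; ring
    rw [e] at hk
    have hG : Real.Gamma ((k:ℝ) + d/2) ≠ 0 := (Real.Gamma_pos_of_pos (by positivity)).ne'
    have hg := gamma_half k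
    have hp : Real.pi ^ ((d:ℝ)/2) = √Real.pi ^ (d-1) * √Real.pi := by
      rw [← pow_succ, Nat.sub_add_cancel hd, Real.sqrt_eq_rpow, ← Real.rpow_natCast, ← Real.rpow_mul Real.pi_pos.le]
      congr 1; ring
    simp only [Function.comp]
    have hM := (eq_div_iff (by positivity)).2 hk
    have hg' := (eq_div_iff (by positivity)).2 hg
    rw [hM, hg', hp, div_pow, ← pow_mul]
    have : ((2*k).factorial : ℝ) ≠ 0 := by positivity
    have : (k.factorial : ℝ) ≠ 0 := by positivity
    field_simp
  · intro n hn
    have ho : Odd n := by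
      rw [← Nat.not_even_iff_odd]
      rintro ⟨m, hm⟩
      exact hn ⟨m, by simp; omega⟩
    have hk := key n
    rw [line_odd n ho, zero_mul] at hk
    have hG : Real.Gamma (((n:ℝ) + d)/2) / 2 ≠ 0 := by
      have := Real.Gamma_pos_of_pos (s := ((n:ℝ) + d)/2) (by positivity)
      positivity
    rw [(mul_eq_zero.1 hk).resolve_right hG, mul_zero]
end

section
/- The heat kernel semigroup property for the rank-one Laguerre heat kernel: define for λ > 0 and s,t > 0, x,y ≥ 0, Γ(t,x,y) = (2t)^{−λ} e^{−(x+y)/t} B(xy/t²) where B(w) = Γ(λ) Ĩ_{λ−1}(2√w). Then with dμ_λ(z) = (2^λ/Γ(λ)) z^{λ−1}dz on (0,∞): ∫_0^∞ Γ(s,x,z) Γ(t,y,z) dμ_λ(z) = Γ(s+t,x,y). -/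
/-- `B(w) = Γ(λ) Ĩ_{λ−1}(2√w) = Γ(λ) ∑ₙ wⁿ/(Γ(n+λ) n!)`. -/
noncomputable def Bfun (l : ℝ) (w : ℝ) : ℝ :=
  Real.Gamma l * ∑' n : ℕ, w ^ n / (Real.Gamma ((n : ℝ) + l) * (n.factorial : ℝ))

/-- The rank-one Laguerre heat kernel `Γ(t,x,y) = (2t)^{−λ} e^{−(x+y)/t} B(xy/t²)`. -/
noncomputable def heatKer (l t x y : ℝ) : ℝ :=
  (2 * t) ^ (-l) * Real.exp (-(x + y) / t) * Bfun l (x * y / t ^ 2)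

lemma aux_vandermonde (m : ℕ) : ∀ (n : ℕ) (l : ℝ), 0 < l →
    ∑ k ∈ Finset.range (m + 1), (m.choose k : ℝ) * (n.descFactorial k : ℝ) / Real.Gamma (k + l)
      = Real.Gamma (m + n + l) / (Real.Gamma (m + l) * Real.Gamma (n + l)) := by
  induction m with
  | zero =>
    intro n l hl
    have h1 := (Real.Gamma_pos_of_pos hl).ne'
    have h2 := (Real.Gamma_pos_of_pos (show 0 < (n : ℝ) + l by positivity)).ne'
    simp
    field_simp
  | succ m ih =>
    intro n l hl
    have e1 : ∑ k ∈ Finset.range (m + 1 + 1), ((m + 1).choose k : ℝ) * (n.descFactorial k : ℝ) / Real.Gamma (k + l)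
        = ∑ k ∈ Finset.range (m + 1), (m.choose k : ℝ) * (n.descFactorial k : ℝ) / Real.Gamma (k + l)
         + ∑ k ∈ Finset.range (m + 1), (m.choose k : ℝ) * (n.descFactorial (k + 1) : ℝ) / Real.Gamma (k + (l + 1)) := by
      rw [Finset.sum_range_succ' _ (m + 1)]
      have e2 : ∑ k ∈ Finset.range (m + 1), (m.choose k : ℝ) * (n.descFactorial k : ℝ) / Real.Gamma (k + l)
          = ∑ k ∈ Finset.range (m + 1), (m.choose (k + 1) : ℝ) * (n.descFactorial (k + 1) : ℝ) / Real.Gamma ((k + 1 : ℕ) + l)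
            + (m.choose 0 : ℝ) * (n.descFactorial 0 : ℝ) / Real.Gamma ((0 : ℕ) + l) := by
        rw [← Finset.sum_range_succ' (fun k : ℕ => (m.choose k : ℝ) * (n.descFactorial k : ℝ) / Real.Gamma (k + l)) (m + 1),
          Finset.sum_range_succ _ (m + 1)]
        simp
      rw [e2, add_right_comm, ← Finset.sum_add_distrib]
      congr 1
      · apply Finset.sum_congr rfl
        intro k _
        rw [Nat.choose_succ_succ]
        push_cast
        rw [show (k : ℝ) + (l + 1) = k + 1 + l by ring]
        ring
      · simp
    rw [e1, ih n l hl]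
    have hm : 0 < (m : ℝ) + l := by positivity
    have hn : 0 < (n : ℝ) + l := by positivity
    have hmn : 0 < (m : ℝ) + n + l := by positivity
    have gm := (Real.Gamma_pos_of_pos hm).ne'
    have gn := (Real.Gamma_pos_of_pos hn).ne'
    have r1 : Real.Gamma (((m + 1 : ℕ) : ℝ) + l) = (m + l) * Real.Gamma (m + l) := by
      rw [← Real.Gamma_add_one hm.ne']; congr 1; push_cast; ring
    have r2 : Real.Gamma (((m + 1 : ℕ) : ℝ) + n + l) = (m + n + l) * Real.Gamma (m + n + l) := by
      rw [← Real.Gamma_add_one hmn.ne']; congr 1; push_cast; ring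
    rw [r1, r2]
    cases n with
    | zero =>
      simp only [Nat.zero_descFactorial_succ]
      simp at *
      field_simp
    | succ n =>
      have e3 : ∑ k ∈ Finset.range (m + 1), (m.choose k : ℝ) * ((n + 1).descFactorial (k + 1) : ℝ) / Real.Gamma (k + (l + 1))
        = (n + 1) * ∑ k ∈ Finset.range (m + 1), (m.choose k : ℝ) * (n.descFactorial k : ℝ) / Real.Gamma (k + (l + 1)) := by
        rw [Finset.mul_sum]
        apply Finset.sum_congr rfl
        intro k _
        rw [Nat.succ_descFactorial_succ]
        push_cast
        ring
      rw [e3, ih n (l + 1) (by positivity)]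
      have r3 : Real.Gamma ((m : ℝ) + (l + 1)) = (m + l) * Real.Gamma (m + l) := by
        rw [← Real.Gamma_add_one hm.ne']; congr 1; ring
      have r4 : (n : ℝ) + (l + 1) = ((n + 1 : ℕ) : ℝ) + l := by push_cast; ring
      have r5 : (m : ℝ) + n + (l + 1) = (m : ℝ) + ((n + 1 : ℕ) : ℝ) + l := by push_cast; ring
      rw [r3, r4, r5]
      field_simp
      push_cast
      ring

lemma aux_summable (l : ℝ) (hl : 0 < l) (w : ℝ) (hw : 0 ≤ w) :
    Summable fun n : ℕ => w ^ n / (Real.Gamma ((n : ℝ) + l) * (n.factorial : ℝ)) := by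
  rw [← summable_nat_add_iff 2]
  have h := (summable_nat_add_iff 2).2 (Real.summable_pow_div_factorial w)
  refine Summable.of_nonneg_of_le (fun n => ?_) (fun n => ?_) h
  · have := Real.Gamma_pos_of_pos (show 0 < ((n + 2 : ℕ) : ℝ) + l by positivity)
    positivity
  · have h1 : 1 ≤ Real.Gamma (((n + 2 : ℕ) : ℝ) + l) := by
      rw [← Real.Gamma_two]
      refine Real.Gamma_strictMonoOn_Ici.monotoneOn (by simp) ?_ ?_
      · simp only [Set.mem_Ici]; push_cast; linarith [(Nat.cast_nonneg n : (0 : ℝ) ≤ n)]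
      · push_cast; linarith [(Nat.cast_nonneg n : (0 : ℝ) ≤ n)]
    gcongr
    have : (0 : ℝ) < ((n + 2).factorial : ℝ) := by positivity
    nlinarith

lemma aux_double (l : ℝ) (hl : 0 < l) (A B : ℝ) (hA : 0 ≤ A) (hB : 0 ≤ B) :
    HasSum (fun q : ℕ × ℕ => A ^ q.1 * B ^ q.2 / (q.1.factorial * q.2.factorial) *
        (Real.Gamma (q.1 + q.2 + l) / (Real.Gamma (q.1 + l) * Real.Gamma (q.2 + l))))
      (Real.exp A * Real.exp B * ∑' n : ℕ, (A * B) ^ n / (Real.Gamma ((n : ℝ) + l) * (n.factorial : ℝ))) := by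
  have hexp : ∀ z : ℝ, HasSum (fun n : ℕ => z ^ n / (n.factorial : ℝ)) (Real.exp z) := by
    intro z
    rw [Real.exp_eq_exp_ℝ]
    exact NormedSpace.expSeries_div_hasSum_exp z
  have h3s := aux_summable l hl (A * B) (by positivity)
  have nn : ∀ z : ℝ, 0 ≤ z → (0 : ℕ → ℝ) ≤ fun n : ℕ => z ^ n / (n.factorial : ℝ) := by
    intro z hz n; simp only [Pi.zero_apply]; positivity
  have h12s := (hexp A).summable.mul_of_nonneg (hexp B).summable (nn A hA) (nn B hB)
  have h12 := (hexp A).mul (hexp B) h12s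
  have h123s := h12s.mul_of_nonneg h3s
    (by intro q; simp only [Pi.zero_apply]; positivity)
    (by
      intro n; simp only [Pi.zero_apply]
      have := Real.Gamma_pos_of_pos (show 0 < (n : ℝ) + l by positivity)
      positivity)
  have h123 := h12.mul h3s.hasSum h123s
  let e : (ℕ × ℕ) × ℕ → (ℕ × ℕ) × ℕ := fun q => ((q.1.1 + q.2, q.1.2 + q.2), q.2)
  have he : Function.Injective e := by
    rintro ⟨⟨i, j⟩, k⟩ ⟨⟨i', j'⟩, k'⟩ h
    simp only [e, Prod.mk.injEq] at h ⊢
    omega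
  let F : (ℕ × ℕ) × ℕ → ℝ := fun q => A ^ q.1.1 * B ^ q.1.2 / (q.1.1.factorial * q.1.2.factorial) *
    ((q.1.1.choose q.2 : ℝ) * (q.1.2.descFactorial q.2 : ℝ) / Real.Gamma (q.2 + l))
  have hF0 : ∀ q, q ∉ Set.range e → F q = 0 := by
    rintro ⟨⟨m, n⟩, k⟩ h
    have : m < k ∨ n < k := by
      by_contra hc
      push Not at hc
      apply h
      refine ⟨((m - k, n - k), k), ?_⟩
      change ((m - k + k, n - k + k), k) = ((m, n), k)
      rw [Nat.sub_add_cancel hc.1, Nat.sub_add_cancel hc.2]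
    rcases this with h | h
    · simp [F, Nat.choose_eq_zero_of_lt h]
    · simp [F, Nat.descFactorial_eq_zero_iff_lt.2 h]
  have hFs : HasSum F (Real.exp A * Real.exp B * ∑' n : ℕ, (A * B) ^ n / (Real.Gamma ((n : ℝ) + l) * (n.factorial : ℝ))) := by
    rw [← he.hasSum_iff hF0]
    refine Eq.subst (motive := fun f => HasSum f _) (funext fun q => ?_) h123
    symm
    obtain ⟨⟨i, j⟩, k⟩ := q
    simp only [F, e, Function.comp]
    have c1 : ((i + k).choose k : ℝ) * i.factorial * k.factorial = (i + k).factorial := by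
      exact_mod_cast Nat.add_choose_mul_factorial_mul_factorial i k
    have c2 : (j.factorial : ℝ) * ((j + k).descFactorial k : ℝ) = (j + k).factorial := by
      have := Nat.factorial_mul_descFactorial (show k ≤ j + k by omega)
      rw [Nat.add_sub_cancel] at this
      exact_mod_cast this
    have g := (Real.Gamma_pos_of_pos (show 0 < (k : ℝ) + l by positivity)).ne'
    have p1 : (i.factorial : ℝ) ≠ 0 := by positivity
    have p2 : (j.factorial : ℝ) ≠ 0 := by positivity
    have p3 : (k.factorial : ℝ) ≠ 0 := by positivity
    have p4 : ((i + k).choose k : ℝ) ≠ 0 := by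
      have : 0 < (i + k).choose k := Nat.choose_pos (by omega)
      positivity
    have p5 : ((j + k).descFactorial k : ℝ) ≠ 0 := by
      intro h
      rw [h, mul_zero] at c2
      have : ((j + k).factorial : ℝ) ≠ 0 := by positivity
      exact this c2.symm
    rw [← c1, ← c2]
    field_simp
    ring
  refine hFs.prod_fiberwise ?_
  rintro ⟨m, n⟩
  have hv := aux_vandermonde m n l hl
  simp only [F]
  rw [← hv, Finset.mul_sum]
  refine hasSum_sum_of_ne_finset_zero ?_
  intro k hk
  have : m < k := by simpa using hk
  simp [Nat.choose_eq_zero_of_lt this]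

lemma aux_weber (l : ℝ) (hl : 0 < l) (a b p : ℝ) (ha : 0 ≤ a) (hb : 0 ≤ b) (hp : 0 < p) :
    ∫ z in Set.Ioi (0 : ℝ), (∑' n : ℕ, (a * z) ^ n / (Real.Gamma ((n : ℝ) + l) * (n.factorial : ℝ))) *
        (∑' n : ℕ, (b * z) ^ n / (Real.Gamma ((n : ℝ) + l) * (n.factorial : ℝ))) *
        (z ^ (l - 1) * Real.exp (-(p * z)))
      = p ^ (-l) * (Real.exp (a / p) * Real.exp (b / p) *
        ∑' n : ℕ, (a / p * (b / p)) ^ n / (Real.Gamma ((n : ℝ) + l) * (n.factorial : ℝ))) := by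
  have hG : ∀ n : ℕ, 0 < Real.Gamma ((n : ℝ) + l) := fun n =>
    Real.Gamma_pos_of_pos (by positivity)
  let c : ℕ × ℕ → ℝ := fun q => a ^ q.1 * b ^ q.2 / (Real.Gamma (q.1 + l) * q.1.factorial * (Real.Gamma (q.2 + l) * q.2.factorial))
  have hc : ∀ q, 0 ≤ c q := by
    intro q
    have := hG q.1
    have := hG q.2
    simp only [c]; positivity
  let F : ℕ × ℕ → ℝ → ℝ := fun q z => c q * (z ^ ((q.1 + q.2 + l) - 1) * Real.exp (-(p * z)))
  have hq : ∀ q : ℕ × ℕ, 0 < (q.1 : ℝ) + q.2 + l := fun q => by positivity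
  have hint : ∀ q : ℕ × ℕ, ∫ z in Set.Ioi (0 : ℝ), z ^ (((q.1 : ℝ) + q.2 + l) - 1) * Real.exp (-(p * z))
      = (1 / p) ^ ((q.1 : ℝ) + q.2 + l) * Real.Gamma (q.1 + q.2 + l) := fun q =>
    Real.integral_rpow_mul_exp_neg_mul_Ioi (hq q) hp
  have hFint : ∀ q, MeasureTheory.Integrable (F q) (MeasureTheory.volume.restrict (Set.Ioi 0)) := by
    intro q
    refine MeasureTheory.Integrable.const_mul ?_ _
    apply MeasureTheory.Integrable.of_integral_ne_zero
    rw [hint q]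
    have := Real.Gamma_pos_of_pos (hq q)
    positivity
  have hFval : ∀ q : ℕ × ℕ, ∫ z in Set.Ioi (0 : ℝ), F q z = p ^ (-l) * ((a / p) ^ q.1 * (b / p) ^ q.2 / (q.1.factorial * q.2.factorial) *
        (Real.Gamma (q.1 + q.2 + l) / (Real.Gamma (q.1 + l) * Real.Gamma (q.2 + l)))) := by
    intro q
    simp only [F]
    rw [MeasureTheory.integral_const_mul, hint q, one_div, Real.inv_rpow hp.le, Real.rpow_add hp, Real.rpow_add hp,
      Real.rpow_natCast, Real.rpow_natCast, Real.rpow_neg hp.le]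
    have := (hG q.1).ne'
    have := (hG q.2).ne'
    have := (Real.rpow_pos_of_pos hp l).ne'
    simp only [c, div_pow]
    field_simp
  have hd := (aux_double l hl (a / p) (b / p) (by positivity) (by positivity)).mul_left (p ^ (-l))
  have hnorm : ∀ q : ℕ × ℕ, ∫ z in Set.Ioi (0 : ℝ), ‖F q z‖ = ∫ z in Set.Ioi (0 : ℝ), F q z := by
    intro q
    refine MeasureTheory.setIntegral_congr_fun measurableSet_Ioi ?_
    intro z hz
    have hz : (0 : ℝ) < z := hz
    have := hc q
    exact Real.norm_of_nonneg (by simp only [F]; positivity)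
  have hs := MeasureTheory.hasSum_integral_of_summable_integral_norm hFint
    (by simp only [hnorm, hFval]; exact hd.summable)
  simp only [hFval] at hs
  rw [← hs.unique hd]
  refine MeasureTheory.setIntegral_congr_fun measurableSet_Ioi ?_
  intro z hz
  have hz : (0 : ℝ) < z := hz
  have s1 := aux_summable l hl (a * z) (by positivity)
  have s2 := aux_summable l hl (b * z) (by positivity)
  have n1 : ∀ w : ℝ, 0 ≤ w → (0 : ℕ → ℝ) ≤ fun n : ℕ => w ^ n / (Real.Gamma ((n : ℝ) + l) * (n.factorial : ℝ)) := by
    intro w hw n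
    have := hG n
    simp only [Pi.zero_apply]; positivity
  have s12 := s1.mul_of_nonneg s2 (n1 _ (by positivity)) (n1 _ (by positivity))
  have := s1.hasSum.mul s2.hasSum s12
  have := (this.mul_right (z ^ (l - 1) * Real.exp (-(p * z)))).tsum_eq
  simp only []
  rw [← this]
  apply tsum_congr
  intro q
  simp only [F, c]
  rw [show (q.1 : ℝ) + q.2 + l - 1 = q.1 + q.2 + (l - 1) by ring, Real.rpow_add hz, Real.rpow_add hz,
    Real.rpow_natCast, Real.rpow_natCast]
  have := (hG q.1).ne'
  have := (hG q.2).ne'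
  rw [mul_pow, mul_pow]
  field_simp

/-- Semigroup property of the rank-one heat kernel with respect to the measure
`dμ_λ(z) = (2^λ/Γ(λ)) z^{λ−1} dz` on `(0,∞)`:
`∫_0^∞ Γ(s,x,z) Γ(t,y,z) dμ_λ(z) = Γ(s+t,x,y)`. -/
theorem stmt_17 (l : ℝ) (hl : 0 < l) (s t x y : ℝ)
    (hs : 0 < s) (ht : 0 < t) (hx : 0 ≤ x) (hy : 0 ≤ y) :
    ∫ z in Set.Ioi (0 : ℝ),
        heatKer l s x z * heatKer l t y z * ((2 ^ l / Real.Gamma l) * z ^ (l - 1))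
      = heatKer l (s + t) x y := by
  have hg := Real.Gamma_pos_of_pos hl
  have hp : 0 < 1 / s + 1 / t := by positivity
  have hw := aux_weber l hl (x / s ^ 2) (y / t ^ 2) (1 / s + 1 / t) (by positivity) (by positivity) hp
  have hstep : ∀ z ∈ Set.Ioi (0 : ℝ),
      heatKer l s x z * heatKer l t y z * ((2 ^ l / Real.Gamma l) * z ^ (l - 1))
      = ((2 * s) ^ (-l) * (2 * t) ^ (-l) * 2 ^ l * Real.Gamma l * Real.exp (-x / s - y / t)) *
        ((∑' n : ℕ, (x / s ^ 2 * z) ^ n / (Real.Gamma ((n : ℝ) + l) * (n.factorial : ℝ))) *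
        (∑' n : ℕ, (y / t ^ 2 * z) ^ n / (Real.Gamma ((n : ℝ) + l) * (n.factorial : ℝ))) *
        (z ^ (l - 1) * Real.exp (-((1 / s + 1 / t) * z)))) := by
    intro z hz
    have e1 : Real.exp (-(x + z) / s) * Real.exp (-(y + z) / t)
        = Real.exp (-x / s - y / t) * Real.exp (-((1 / s + 1 / t) * z)) := by
      rw [← Real.exp_add, ← Real.exp_add]; congr 1; ring
    unfold heatKer Bfun
    rw [show x * z / s ^ 2 = x / s ^ 2 * z by ring, show y * z / t ^ 2 = y / t ^ 2 * z by ring]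
    generalize (∑' n : ℕ, (x / s ^ 2 * z) ^ n / (Real.Gamma ((n : ℝ) + l) * (n.factorial : ℝ))) = S1
    generalize (∑' n : ℕ, (y / t ^ 2 * z) ^ n / (Real.Gamma ((n : ℝ) + l) * (n.factorial : ℝ))) = S2
    calc _ = (Real.exp (-(x + z) / s) * Real.exp (-(y + z) / t)) * ((2 * s) ^ (-l) * (2 * t) ^ (-l) * 2 ^ l * S1 * S2
              * z ^ (l - 1) * (Real.Gamma l * Real.Gamma l / Real.Gamma l)) := by ring
      _ = _ := by rw [e1, mul_div_cancel_right₀ _ hg.ne']; ring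
  rw [MeasureTheory.setIntegral_congr_fun measurableSet_Ioi hstep, MeasureTheory.integral_const_mul, hw]
  unfold heatKer Bfun
  have hst : 0 < s + t := by positivity
  rw [show x / s ^ 2 / (1 / s + 1 / t) * (y / t ^ 2 / (1 / s + 1 / t)) = x * y / (s + t) ^ 2 by
    field_simp; ring]
  have e2 : Real.exp (-x / s - y / t) * (Real.exp (x / s ^ 2 / (1 / s + 1 / t)) * Real.exp (y / t ^ 2 / (1 / s + 1 / t)))
      = Real.exp (-(x + y) / (s + t)) := by
    rw [← Real.exp_add, ← Real.exp_add]; congr 1; field_simp; ring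
  have e3 : (2 * s) ^ (-l) * (2 * t) ^ (-l) * 2 ^ l * (1 / s + 1 / t) ^ (-l) = (2 * (s + t)) ^ (-l) := by
    have h2 : (2 : ℝ) ^ l = (1 / 2 : ℝ) ^ (-l) := by
      rw [one_div, Real.inv_rpow (by norm_num), Real.rpow_neg (by norm_num), inv_inv]
    rw [h2, ← Real.mul_rpow (by positivity) (by positivity), ← Real.mul_rpow (by positivity) (by positivity),
      ← Real.mul_rpow (by positivity) (by positivity)]
    congr 1
    field_simp
    try ring
  rw [← e2, ← e3]
  ring
end
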